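/- (Lam–Leung) Let l ≥ 1 be an integer and let p_1,…,p_k be the distinct prime divisors of l. If λ_1,…,λ_N ∈ ℂ are l-th roots of unity (not necessarily distinct) satisfying λ_1 + λ_2 + ⋯ + λ_N = 0, then N is a nonnegative integer combination of p_1,…,p_k, i.e. N ∈ p_1·ℕ + ⋯ + p_k·ℕ. -/

import Mathlib

open Polynomial

theorem exists_polynomial_aeval_pow {n : ℕ} [NeZero n] {ζ : ℂ} (hζ : IsPrimitiveRoot ζ n)
    (X : Multiset ℂ) (hX : ∀ z ∈ X, z ^ n = 1) :
    ∃ P : ℤ[X], ∀ k : ℕ, aeval (ζ ^ k) P = (X.map (· ^ k)).sum := by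
  induction X using Multiset.induction_on with
  | empty => exact ⟨0, by simp⟩
  | cons z X ih =>
    obtain ⟨P, hP⟩ := ih fun w hw => hX w (Multiset.mem_cons_of_mem hw)
    obtain ⟨e, -, rfl⟩ := hζ.eq_pow_of_pow_eq_one (hX z (Multiset.mem_cons_self _ _))
    exact ⟨Polynomial.X ^ e + P, fun k => by simp [hP, ← pow_mul, mul_comm]⟩

theorem sum_map_pow_eq_of_coprime {n k : ℕ} (hn : n ≠ 0) (hk : k.Coprime n) {X Y : Multiset ℂ}
    (hX : ∀ z ∈ X, z ^ n = 1) (hY : ∀ z ∈ Y, z ^ n = 1) (h : X.sum = Y.sum) :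
    (X.map (· ^ k)).sum = (Y.map (· ^ k)).sum := by
  have : NeZero n := ⟨hn⟩
  have hζ := Complex.isPrimitiveRoot_exp n hn
  set ζ := Complex.exp (2 * Real.pi * Complex.I / n)
  obtain ⟨P, hP⟩ := exists_polynomial_aeval_pow hζ X hX
  obtain ⟨Q, hQ⟩ := exists_polynomial_aeval_pow hζ Y hY
  have h0 : aeval ζ (P - Q) = 0 := by
    have h1 := hP 1
    have h2 := hQ 1
    simp only [pow_one, Multiset.map_id'] at h1 h2
    rw [map_sub, h1, h2, h, sub_self]
  obtain ⟨R, hR⟩ := minpoly.isIntegrallyClosed_dvd (hζ.isIntegral (Nat.pos_of_ne_zero hn)) h0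
  have h3 : aeval (ζ ^ k) (P - Q) = 0 := by
    rw [hR, hζ.minpoly_eq_pow_coprime hk, map_mul, minpoly.aeval, zero_mul]
  rwa [map_sub, hP, hQ, sub_eq_zero] at h3

/-- The elements of `X` whose `n`-th power is `ω ^ j`, multiplied by `ζ ^ (-j)`. -/
noncomputable def rootPart (X : Multiset ℂ) (n : ℕ) (ω ζ : ℂ) (j : ℕ) : Multiset ℂ :=
  (X.filter fun z => z ^ n = ω ^ j).map (· * (ζ ^ j)⁻¹)

theorem rootPart_cons_of_pos (X : Multiset ℂ) {n : ℕ} {ω : ℂ} (ζ : ℂ) {j : ℕ} {z : ℂ}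
    (h : z ^ n = ω ^ j) :
    rootPart (z ::ₘ X) n ω ζ j = (z * (ζ ^ j)⁻¹) ::ₘ rootPart X n ω ζ j := by
  rw [rootPart, Multiset.filter_cons_of_pos (p := fun z => z ^ n = ω ^ j) X h,
    Multiset.map_cons, rootPart]

theorem rootPart_cons_of_neg (X : Multiset ℂ) {n : ℕ} {ω : ℂ} (ζ : ℂ) {j : ℕ} {z : ℂ}
    (h : z ^ n ≠ ω ^ j) : rootPart (z ::ₘ X) n ω ζ j = rootPart X n ω ζ j := by
  rw [rootPart, Multiset.filter_cons_of_neg (p := fun z => z ^ n = ω ^ j) X h, rootPart]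

theorem pow_eq_one_of_mem_rootPart {X : Multiset ℂ} {n : ℕ} {ω ζ : ℂ} (hω : ω ≠ 0)
    (hζ : ζ ^ n = ω) {j : ℕ} {z : ℂ} (hz : z ∈ rootPart X n ω ζ j) : z ^ n = 1 := by
  simp only [rootPart, Multiset.mem_map, Multiset.mem_filter] at hz
  obtain ⟨w, ⟨-, hw⟩, rfl⟩ := hz
  rw [mul_pow, hw, inv_pow, ← pow_mul, mul_comm j, pow_mul, hζ, mul_inv_cancel₀ (pow_ne_zero _ hω)]

theorem sum_card_rootPart {X : Multiset ℂ} {p n : ℕ} [NeZero p] {ω : ℂ} (hω : IsPrimitiveRoot ω p)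
    (ζ : ℂ) (hX : ∀ z ∈ X, z ^ (p * n) = 1) :
    ∑ j ∈ Finset.range p, (rootPart X n ω ζ j).card = X.card := by
  induction X using Multiset.induction_on with
  | empty => simp [rootPart]
  | cons z X ih =>
    have ih := ih fun w hw => hX w (Multiset.mem_cons_of_mem hw)
    have hz := hX z (Multiset.mem_cons_self _ _)
    obtain ⟨e, he, hze⟩ := hω.eq_pow_of_pow_eq_one (ξ := z ^ n) (by rw [← pow_mul, mul_comm, hz])
    have key : ∀ j ∈ Finset.range p, (rootPart (z ::ₘ X) n ω ζ j).card =
        (rootPart X n ω ζ j).card + if e = j then 1 else 0 := by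
      intro j hj
      have : z ^ n = ω ^ j ↔ e = j := by
        rw [← hze]
        exact ⟨fun h => hω.pow_inj he (Finset.mem_range.1 hj) h, fun h => h ▸ rfl⟩
      by_cases h : e = j
      · simp [rootPart_cons_of_pos X ζ (this.2 h), h]
      · simp [rootPart_cons_of_neg X ζ (fun h' => h (this.1 h')), h]
    rw [Finset.sum_congr rfl key, Finset.sum_add_distrib, ih]
    simp [he]

theorem mul_sum_rootPart {X : Multiset ℂ} {p n : ℕ} {ω : ℂ} (hp : 1 < p)
    (hω : IsPrimitiveRoot ω p) (ζ : ℂ) (j : ℕ) (hX : ∀ z ∈ X, z ^ (p * n) = 1) :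
    p * (rootPart X n ω ζ j).sum = (ζ ^ j)⁻¹ *
      ∑ i ∈ Finset.range p, ((ω ^ j)⁻¹) ^ i * (X.map (· ^ (1 + n * i))).sum := by
  have hω0 : ω ^ j ≠ 0 := pow_ne_zero _ (hω.ne_zero (by lia))
  induction X using Multiset.induction_on with
  | empty => simp [rootPart]
  | cons z X ih =>
    have ih := ih fun w hw => hX w (Multiset.mem_cons_of_mem hw)
    have hz := hX z (Multiset.mem_cons_self _ _)
    have hsum : ∑ i ∈ Finset.range p, ((ω ^ j)⁻¹) ^ i * z ^ (1 + n * i) =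
        z * ∑ i ∈ Finset.range p, ((ω ^ j)⁻¹ * z ^ n) ^ i := by
      rw [Finset.mul_sum]
      exact Finset.sum_congr rfl fun i _ => by rw [mul_pow, pow_add, pow_mul]; ring
    simp only [Multiset.map_cons, Multiset.sum_cons, mul_add, Finset.sum_add_distrib]
    rw [← ih, hsum]
    by_cases h : z ^ n = ω ^ j
    · rw [rootPart_cons_of_pos X ζ h, h, inv_mul_cancel₀ hω0, Multiset.sum_cons]
      simp
      ring
    · have h1 : (ω ^ j)⁻¹ * z ^ n ≠ 1 := by
        rwa [Ne, inv_mul_eq_one₀ hω0, eq_comm]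
      have h2 : ((ω ^ j)⁻¹ * z ^ n) ^ p = 1 := by
        rw [mul_pow, inv_pow, ← pow_mul, ← pow_mul, mul_comm j, pow_mul, hω.pow_eq_one, one_pow,
          mul_comm n, hz, inv_one, one_mul]
      rw [geom_sum_eq h1, h2]
      simp [rootPart_cons_of_neg X ζ h]

/-- If `p ∣ n`, equal sums of `p * n`-th roots of unity have equal parts. -/
theorem sum_rootPart_eq_of_dvd {X Y : Multiset ℂ} {p n : ℕ} {ω : ℂ} (hp : 1 < p) (hn : n ≠ 0)
    (hpn : p ∣ n) (hω : IsPrimitiveRoot ω p) (ζ : ℂ) (hX : ∀ z ∈ X, z ^ (p * n) = 1)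
    (hY : ∀ z ∈ Y, z ^ (p * n) = 1) (h : X.sum = Y.sum) (j : ℕ) :
    (rootPart X n ω ζ j).sum = (rootPart Y n ω ζ j).sum := by
  have hp0 : (p : ℂ) ≠ 0 := by norm_cast; lia
  apply mul_left_cancel₀ hp0
  rw [mul_sum_rootPart hp hω ζ j hX, mul_sum_rootPart hp hω ζ j hY]
  congr 1
  refine Finset.sum_congr rfl fun i _ => ?_
  rw [sum_map_pow_eq_of_coprime (by positivity) _ hX hY h]
  have h1 : (1 + n * i).Coprime n := by simp
  exact Nat.Coprime.mul_right (h1.coprime_dvd_right hpn) h1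

/-- If `p` is prime to `n`, then for equal sums of `p * n`-th roots of unity the differences of the
corresponding parts do not depend on the part. -/
theorem exists_sum_rootPart_sub_eq {p n : ℕ} (hp : p.Prime) (hn : n ≠ 0)
    (hpn : p.Coprime n) : ∃ ω ζ : ℂ, IsPrimitiveRoot ω p ∧ ζ ^ n = ω ∧
    ∀ X Y : Multiset ℂ, (∀ z ∈ X, z ^ (p * n) = 1) → (∀ z ∈ Y, z ^ (p * n) = 1) →
    X.sum = Y.sum → ∀ i j : ℕ,
      (rootPart X n ω ζ i).sum - (rootPart Y n ω ζ i).sum =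
      (rootPart X n ω ζ j).sum - (rootPart Y n ω ζ j).sum := by
  have hp0 : (p : ℂ) ≠ 0 := by exact_mod_cast hp.ne_zero
  have hω := Complex.isPrimitiveRoot_exp p hp.ne_zero
  set ω := Complex.exp (2 * Real.pi * Complex.I / p)
  have hω0 : ω ≠ 0 := hω.ne_zero hp.ne_zero
  have : Fact p.Prime := ⟨hp⟩
  have hn0 : (n : ZMod p) ≠ 0 := by
    rw [Ne, ZMod.natCast_eq_zero_iff]
    exact (Nat.Prime.coprime_iff_not_dvd hp).1 hpn
  set i₀ : ℕ := (-(n : ZMod p)⁻¹).val with hi₀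
  have hi : ∀ i ∈ Finset.range p, i ≠ i₀ → (1 + n * i).Coprime (p * n) := by
    intro i hi hne
    refine Nat.Coprime.mul_right ?_ (by simp)
    rw [Nat.coprime_comm, Nat.Prime.coprime_iff_not_dvd hp, ← ZMod.natCast_eq_zero_iff]
    intro h
    push_cast at h
    apply hne
    have : (i : ZMod p) = -(n : ZMod p)⁻¹ := by
      field_simp
      linear_combination h
    rw [hi₀, ← this, ZMod.val_natCast, Nat.mod_eq_of_lt (Finset.mem_range.1 hi)]
  have hdvd : p ∣ 1 + n * i₀ := by
    rw [← ZMod.natCast_eq_zero_iff]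
    push_cast
    rw [hi₀, ZMod.natCast_zmod_val]
    field_simp
    ring
  refine ⟨ω, (ω ^ i₀)⁻¹, hω, ?_, ?_⟩
  · obtain ⟨c, hc⟩ := hdvd
    have : ω * ω ^ (i₀ * n) = 1 := by
      rw [← pow_succ', show i₀ * n + 1 = p * c by rw [← hc]; ring, pow_mul, hω.pow_eq_one, one_pow]
    rw [inv_pow, ← pow_mul]
    exact inv_eq_of_mul_eq_one_left this
  · intro X Y hX hY h
    suffices H : ∀ j, p * ((rootPart X n ω (ω ^ i₀)⁻¹ j).sum - (rootPart Y n ω (ω ^ i₀)⁻¹ j).sum) =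
        (X.map (· ^ (1 + n * i₀))).sum - (Y.map (· ^ (1 + n * i₀))).sum by
      intro i j
      exact mul_left_cancel₀ hp0 ((H i).trans (H j).symm)
    intro j
    rw [mul_sub, mul_sum_rootPart hp.one_lt hω _ j hX, mul_sum_rootPart hp.one_lt hω _ j hY,
      ← mul_sub, ← Finset.sum_sub_distrib, Finset.sum_eq_single i₀]
    · rw [← mul_sub, ← mul_assoc, inv_pow, inv_inv, inv_pow, ← pow_mul, ← pow_mul, mul_comm j,
        mul_inv_cancel₀ (pow_ne_zero _ hω0), one_mul]
    · intro i hir hne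
      rw [sum_map_pow_eq_of_coprime (mul_ne_zero hp.ne_zero hn) (hi i hir hne) hX hY h, sub_self]
    · intro h'
      exact absurd (Finset.mem_range.2 (ZMod.val_lt _)) h'

/-- Either `b` exceeds `a` by an element of `S`, or `b` is at least `(p - a) * (q - 1)`. -/
def ExceedsOrLarge (S : AddSubmonoid ℕ) (p q a b : ℕ) : Prop :=
  (∃ s ∈ S, b = a + s) ∨ ((p : ℤ) - a) * (q - 1) ≤ b

namespace ExceedsOrLarge

variable {S : AddSubmonoid ℕ} {p q : ℕ}

theorem of_le {a : ℕ} (hpq : p < q) (h : p ≤ a) (b : ℕ) : ExceedsOrLarge S p q a b := by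
  right
  have h1 : (p : ℤ) - a ≤ 0 := by lia
  have h2 : (0 : ℤ) ≤ q - 1 := by lia
  nlinarith

theorem sum_of_forall {ι : Type*} {s : Finset ι} {m e : ι → ℕ} (hpq : p < q)
    (h : ∀ i ∈ s, ExceedsOrLarge S p q (m i) (e i)) :
    ExceedsOrLarge S p q (∑ i ∈ s, m i) (∑ i ∈ s, e i) := by
  by_cases H : ∀ i ∈ s, ∃ t ∈ S, e i = m i + t
  · choose! f hf using H
    refine .inl ⟨∑ i ∈ s, f i, S.sum_mem fun i hi => (hf i hi).1, ?_⟩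
    rw [← Finset.sum_add_distrib]
    exact Finset.sum_congr rfl fun i hi => (hf i hi).2
  · push Not at H
    obtain ⟨i, hi, H⟩ := H
    right
    have h1 : ((p : ℤ) - m i) * (q - 1) ≤ e i :=
      (h i hi).resolve_left fun ⟨t, ht, h⟩ => H t ht h
    have h2 : m i ≤ ∑ i ∈ s, m i := Finset.single_le_sum (fun _ _ => Nat.zero_le _) hi
    have h3 : e i ≤ ∑ i ∈ s, e i := Finset.single_le_sum (fun _ _ => Nat.zero_le _) hi
    zify at h2 h3
    have h4 : (0 : ℤ) ≤ q - 1 := by lia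
    push_cast
    nlinarith

theorem sum_of_forall_zero {ι : Type*} {s : Finset ι} {m e : ι → ℕ} (hpq : p < q)
    (hs : q ≤ s.card) (hS : s.card ∈ S)
    (h : ∀ i ∈ s, ∀ j ∈ s, m j = 0 → ExceedsOrLarge S p q (m i + e j) (e i)) :
    ExceedsOrLarge S p q (∑ i ∈ s, m i) (∑ i ∈ s, e i) := by
  classical
  rcases le_or_gt p (∑ i ∈ s, m i) with hM | hM
  · exact of_le hpq hM _
  have hne : (s.filter fun j => m j = 0).Nonempty := by
    by_contra hne
    rw [Finset.not_nonempty_iff_eq_empty, Finset.filter_eq_empty_iff] at hne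
    have := Finset.card_nsmul_le_sum s m 1 fun i hi => Nat.pos_of_ne_zero (hne hi)
    simp only [smul_eq_mul, mul_one] at this
    lia
  obtain ⟨j, hj, hmin⟩ := Finset.exists_min_image _ e hne
  rw [Finset.mem_filter] at hj
  have hle : ∀ i ∈ s, (e j : ℤ) * (1 - m i) ≤ e i := by
    intro i hi
    rcases Nat.eq_zero_or_pos (m i) with h0 | h0
    · have := hmin i (Finset.mem_filter.2 ⟨hi, h0⟩)
      simpa [h0] using this
    · have : (1 : ℤ) - m i ≤ 0 := by lia
      nlinarith
  by_cases H : ∀ i ∈ s, ∃ t ∈ S, e i = m i + e j + t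
  · choose! f hf using H
    refine .inl ⟨e j • s.card + ∑ i ∈ s, f i,
      S.add_mem (S.nsmul_mem hS _) (S.sum_mem fun i hi => (hf i hi).1), ?_⟩
    rw [Finset.sum_congr rfl fun i hi => (hf i hi).2]
    simp only [Finset.sum_add_distrib, Finset.sum_const, smul_eq_mul]
    ring
  · push Not at H
    obtain ⟨i, hi, H⟩ := H
    right
    have h1 := (h i hi j hj.1 hj.2).resolve_left fun ⟨t, ht, h⟩ => H t ht h
    have h2 := Finset.sum_le_sum fun k (hk : k ∈ s.erase i) => hle k (Finset.mem_of_mem_erase hk)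
    rw [← Finset.mul_sum, Finset.sum_sub_distrib] at h2
    simp only [Finset.sum_const, nsmul_eq_mul, mul_one] at h2
    rw [Finset.cast_card_erase_of_mem hi] at h2
    have hm := Finset.add_sum_erase s (fun k => (m k : ℤ)) hi
    have he := Finset.add_sum_erase s (fun k => (e k : ℤ)) hi
    have h0 : (0 : ℤ) ≤ ∑ k ∈ s.erase i, (m k : ℤ) := Finset.sum_nonneg fun _ _ => by positivity
    zify at hs hM hpq
    push_cast at h1 ⊢
    rw [← hm] at hM ⊢
    rw [← he]
    generalize ∑ k ∈ s.erase i, (m k : ℤ) = M at *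
    generalize ∑ k ∈ s.erase i, (e k : ℤ) = E at *
    have hi' := hle i hi
    have ht : (0 : ℤ) ≤ e j := by positivity
    have hm0 : (0 : ℤ) ≤ m i := by positivity
    generalize (e j : ℤ) = t at *
    have h3 : t * ((q - 1) - M) ≤ E := h2.trans' (mul_le_mul_of_nonneg_left (by linarith) ht)
    rcases le_or_gt t (q - 1) with h4 | h4
    · nlinarith [mul_le_mul_of_nonneg_left h4 h0]
    · have h5 : t * (q - (m i + M)) ≤ e i + E := by linarith
      have h6 : (q - 1) * (q - (m i + M)) ≤ t * (q - (m i + M)) :=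
        mul_le_mul_of_nonneg_right h4.le (by linarith)
      have h7 : ((q : ℤ) - 1) * (p - (m i + M)) ≤ (q - 1) * (q - (m i + M)) :=
        mul_le_mul_of_nonneg_left (by linarith) (by linarith)
      linarith

end ExceedsOrLarge

/-- If two multisets of `n`-th roots of unity have equal sums, then the second has at least
`(p - a) * (q - 1)` elements, with `a` the size of the first, or it exceeds the first by an element
of `S`, provided that `S` contains the prime divisors of `n` and these are `≥ q` or equal to `p`. -/
theorem exceedsOrLarge_card {S : AddSubmonoid ℕ} {p q : ℕ} (hpq : p < q) {n : ℕ} (hn : n ≠ 0)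
    (hS : ∀ r : ℕ, r.Prime → r ∣ n → r ∈ S ∧ (r = p ∨ q ≤ r)) {X Y : Multiset ℂ}
    (hX : ∀ z ∈ X, z ^ n = 1) (hY : ∀ z ∈ Y, z ^ n = 1) (h : X.sum = Y.sum) :
    ExceedsOrLarge S p q X.card Y.card := by
  induction n using Nat.strong_induction_on generalizing X Y with | _ n ih
  have sum_eq_card {Z : Multiset ℂ} (hZ : ∀ z ∈ Z, z ^ 1 = 1) : Z.sum = Z.card := by
    rw [(Multiset.eq_replicate_card (s := Z) (a := 1)).2 fun z hz => by simpa using hZ z hz]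
    simp
  rcases eq_or_ne n 1 with rfl | hn1
  · rw [sum_eq_card hX, sum_eq_card hY, Nat.cast_inj] at h
    exact .inl ⟨0, S.zero_mem, h.symm⟩
  obtain ⟨r, hr, hrn, hrq⟩ : ∃ r : ℕ, r.Prime ∧ r ∣ n ∧
      (q ≤ r ∨ ∀ t : ℕ, t.Prime → t ∣ n → t = r) := by
    by_cases H : ∃ r : ℕ, r.Prime ∧ r ∣ n ∧ q ≤ r
    · obtain ⟨r, hr, hrn, hrq⟩ := H
      exact ⟨r, hr, hrn, .inl hrq⟩
    · push Not at H
      have H' (t : ℕ) (ht : t.Prime) (htn : t ∣ n) : t = p :=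
        (hS t ht htn).2.resolve_right (H t ht htn).not_ge
      obtain ⟨r, hr, hrn⟩ := Nat.exists_prime_and_dvd hn1
      exact ⟨r, hr, hrn, .inr fun t ht htn => (H' t ht htn).trans (H' r hr hrn).symm⟩
  obtain ⟨n, rfl⟩ := hrn
  have hn0 : n ≠ 0 := right_ne_zero_of_mul hn
  have hlt : n < r * n := lt_mul_of_one_lt_left (Nat.pos_of_ne_zero hn0) hr.one_lt
  have ih {X Y : Multiset ℂ} := ih n hlt (X := X) (Y := Y) hn0
    fun t ht htn => hS t ht (htn.mul_left r)
  have : NeZero r := ⟨hr.ne_zero⟩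
  by_cases hrn : r ∣ n
  · have hζ := Complex.isPrimitiveRoot_exp (r * n) hn
    set ζ := Complex.exp (2 * Real.pi * Complex.I / (r * n : ℕ))
    have hω : IsPrimitiveRoot (ζ ^ n) r := hζ.pow (Nat.pos_of_ne_zero hn) (mul_comm _ _)
    have hω0 : ζ ^ n ≠ 0 := hω.ne_zero hr.ne_zero
    rw [← sum_card_rootPart hω ζ hX, ← sum_card_rootPart hω ζ hY]
    exact .sum_of_forall hpq fun i _ => ih (fun z => pow_eq_one_of_mem_rootPart hω0 rfl)
      (fun z => pow_eq_one_of_mem_rootPart hω0 rfl)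
      (sum_rootPart_eq_of_dvd hr.one_lt hn0 hrn hω ζ hX hY h i)
  obtain ⟨ω, ζ, hω, hζ, H⟩ := exists_sum_rootPart_sub_eq hr hn0
    ((Nat.Prime.coprime_iff_not_dvd hr).2 hrn)
  have hω0 : ω ≠ 0 := hω.ne_zero hr.ne_zero
  have H := H X Y hX hY h
  have hXp {j : ℕ} : ∀ z ∈ rootPart X n ω ζ j, z ^ n = 1 :=
    fun z => pow_eq_one_of_mem_rootPart hω0 hζ
  have hYp {j : ℕ} : ∀ z ∈ rootPart Y n ω ζ j, z ^ n = 1 :=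
    fun z => pow_eq_one_of_mem_rootPart hω0 hζ
  rw [← sum_card_rootPart hω ζ hX, ← sum_card_rootPart hω ζ hY]
  obtain ⟨hrS, hrp⟩ := hS r hr (dvd_mul_right r n)
  by_cases hqr : q ≤ r
  · refine .sum_of_forall_zero hpq (by simpa using hqr) (by simpa using hrS) fun i _ j _ hj => ?_
    rw [← Multiset.card_add]
    refine ih (fun z hz => (Multiset.mem_add.1 hz).elim (hXp z) (hYp z)) hYp ?_
    have := H i j
    rw [Multiset.card_eq_zero.1 hj, Multiset.sum_zero] at this
    rw [Multiset.sum_add]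
    linear_combination this
  · obtain rfl : r = p := hrp.resolve_right hqr
    have hn1 : n = 1 := by
      by_contra hn1
      obtain ⟨t, ht, htn⟩ := Nat.exists_prime_and_dvd hn1
      exact hrn (hrq.resolve_left hqr t ht (htn.mul_left r) ▸ htn)
    subst hn1
    have hcard (j : ℕ) : ((rootPart Y 1 ω ζ j).card : ℤ) = (rootPart X 1 ω ζ j).card +
        ((rootPart Y 1 ω ζ 0).card - (rootPart X 1 ω ζ 0).card) := by
      have := H j 0
      rw [sum_eq_card hXp, sum_eq_card hXp, sum_eq_card hYp, sum_eq_card hYp] at this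
      have : ((rootPart X 1 ω ζ j).card : ℤ) - (rootPart Y 1 ω ζ j).card =
          (rootPart X 1 ω ζ 0).card - (rootPart Y 1 ω ζ 0).card := by exact_mod_cast this
      linarith
    have hsum : ((∑ j ∈ Finset.range r, (rootPart Y 1 ω ζ j).card : ℕ) : ℤ) =
        (∑ j ∈ Finset.range r, (rootPart X 1 ω ζ j).card : ℕ) +
        r * ((rootPart Y 1 ω ζ 0).card - (rootPart X 1 ω ζ 0).card) := by
      push_cast
      rw [Finset.sum_congr rfl fun j _ => hcard j, Finset.sum_add_distrib]
      simp [mul_sub]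
    rcases le_or_gt (rootPart X 1 ω ζ 0).card (rootPart Y 1 ω ζ 0).card with hle | hlt
    · obtain ⟨d, hd⟩ := Nat.exists_eq_add_of_le hle
      refine .inl ⟨d • r, S.nsmul_mem hrS d, ?_⟩
      rw [hd] at hsum
      zify
      rw [smul_eq_mul]
      push_cast at hsum ⊢
      linear_combination hsum
    · refine .of_le hpq ?_ _
      zify at hlt ⊢
      push_cast at hsum
      have : (0 : ℤ) ≤ ∑ j ∈ Finset.range r, ((rootPart Y 1 ω ζ j).card : ℤ) :=
        Finset.sum_nonneg fun _ _ => by positivity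
      nlinarith

theorem card_mem_closure_primeFactors {l : ℕ} (hl : l ≠ 0) {X : Multiset ℂ}
    (hX : ∀ z ∈ X, z ^ l = 1) (h : X.sum = 0) :
    X.card ∈ AddSubmonoid.closure (l.primeFactors : Set ℕ) := by
  have hmem (r : ℕ) (hr : r.Prime) (hrl : r ∣ l) :
      r ∈ AddSubmonoid.closure (l.primeFactors : Set ℕ) :=
    AddSubmonoid.subset_closure (Nat.mem_primeFactors.2 ⟨hr, hrl, hl⟩)
  rcases eq_or_ne l 1 with rfl | hl1
  · have := Multiset.eq_replicate_card.2 fun z hz => by simpa using hX z hz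
    rw [this] at h
    have h0 : X.card = 0 := by simpa using h
    rw [h0]
    exact zero_mem _
  have hp := Nat.minFac_prime hl1
  have key (q : ℕ) (hpq : l.minFac < q)
      (hq : ∀ r : ℕ, r.Prime → r ∣ l → r = l.minFac ∨ q ≤ r) :
      X.card ∈ AddSubmonoid.closure (l.primeFactors : Set ℕ) ∨ l.minFac * (q - 1) ≤ X.card := by
    rcases exceedsOrLarge_card (X := 0) hpq hl (fun r hr hrl => ⟨hmem r hr hrl, hq r hr hrl⟩)
      (by simp) hX (by simpa using h.symm) with ⟨s, hs, hc⟩ | hc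
    · left
      simpa [hc] using hs
    · right
      zify [show 1 ≤ q by lia]
      simpa using hc
  by_cases H : ∃ q : ℕ, q.Prime ∧ q ∣ l ∧ q ≠ l.minFac
  · classical
    obtain ⟨hq, hql, hne⟩ := Nat.find_spec H
    have hmin (r : ℕ) (hr : r.Prime) (hrl : r ∣ l) : r = l.minFac ∨ Nat.find H ≤ r :=
      or_iff_not_imp_left.2 fun hrne => Nat.find_min' H ⟨hr, hrl, hrne⟩
    set q := Nat.find H
    have hpq : l.minFac < q := lt_of_le_of_ne (Nat.minFac_le_of_dvd hq.two_le hql) hne.symm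
    refine (key q hpq hmin).elim id fun hc => ?_
    have hfrob := frobeniusNumber_pair ((Nat.coprime_primes hp hq).2 hne.symm) hp.one_lt hq.one_lt
    rw [frobeniusNumber_iff] at hfrob
    refine AddSubmonoid.closure_mono ?_ (hfrob.2 X.card ?_)
    · rintro r (rfl | rfl)
      · exact Nat.mem_primeFactors.2 ⟨hp, l.minFac_dvd, hl⟩
      · exact Nat.mem_primeFactors.2 ⟨hq, hql, hl⟩
    · have := hp.two_le
      have h2 : 2 * q ≤ l.minFac * q := Nat.mul_le_mul_right q this
      rw [Nat.mul_sub, mul_one] at hc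
      lia
  · push Not at H
    refine (key (l.minFac + X.card + 2) (by lia) fun r hr hrl => .inl (H r hr hrl)).elim id
      fun hc => ?_
    have := Nat.le_mul_of_pos_left (l.minFac + X.card + 2 - 1) hp.pos
    lia

/-- Lam–Leung: if `λ_1, …, λ_N` are `l`-th roots of unity with
`λ_1 + ⋯ + λ_N = 0`, then `N` is a nonnegative integer combination of the distinct
prime divisors of `l`: `N ∈ p_1 ℕ + ⋯ + p_k ℕ`. -/
theorem stmt_6 (l : ℕ) (hl : 1 ≤ l) (N : ℕ) (lam : Fin N → ℂ)
    (hroot : ∀ i, (lam i) ^ l = 1)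
    (hsum : ∑ i, lam i = 0) :
    ∃ c : ℕ → ℕ, N = ∑ p ∈ l.primeFactors, c p * p := by
  have h := card_mem_closure_primeFactors (l := l) (by lia) (X := Finset.univ.val.map lam)
    (by simpa using hroot) hsum
  rw [Multiset.card_map, Finset.card_val, Finset.card_univ, Fintype.card_fin] at h
  clear hsum hroot lam
  induction h using AddSubmonoid.closure_induction with
  | mem p hp =>
    exact ⟨Pi.single p 1, by simp [Pi.single_apply, Finset.mem_coe.1 hp]⟩
  | zero => exact ⟨0, by simp⟩
  | add a b _ _ ha hb =>
    obtain ⟨c, rfl⟩ := ha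
    obtain ⟨d, rfl⟩ := hb
    exact ⟨c + d, by simp [add_mul, Finset.sum_add_distrib]⟩
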